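/- For every real number θ with 0 < θ < π/2, there do not exist a measurable space Λ, a probability measure X on Λ, measurable sets A, B ⊆ Λ with X(A ∪ B) = 1, and measurable functions ξ_a, ξ_b : Λ → [0,1] with ξ_a(λ) = 1 for all λ ∈ A and ξ_b(λ) = 1 for all λ ∈ B, such that ∫ ξ_a dX = sin²(θ/2) and ∫ ξ_b dX = sin²(θ/2). -/

import Mathlib

open MeasureTheory

/-- Measure-theoretic, deficiency-robust two-ensemble steering contradiction:
for `0 < θ < π/2` there is no probability measure `X`, measurable sets `A`, `B`
with `X(A ∪ B) = 1`, and measurable response functions `ξa, ξb : Λ → [0,1]`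
equal to `1` on `A` resp. `B`, whose integrals against `X` both equal
`sin²(θ/2)`. -/
theorem steering_two_ensembles_deficient_no_lhv_measure (θ : ℝ)
    (hθ0 : 0 < θ) (hθ1 : θ < Real.pi / 2) :
    ¬ ∃ (Λ : Type) (_ : MeasurableSpace Λ) (X : Measure Λ)
      (_ : IsProbabilityMeasure X) (A B : Set Λ) (ξa ξb : Λ → ℝ),
        MeasurableSet A ∧ MeasurableSet B ∧
        Measurable ξa ∧ Measurable ξb ∧
        (∀ l, ξa l ∈ Set.Icc (0 : ℝ) 1) ∧ (∀ l, ξb l ∈ Set.Icc (0 : ℝ) 1) ∧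
        (∀ l ∈ A, ξa l = 1) ∧ (∀ l ∈ B, ξb l = 1) ∧
        X (A ∪ B) = 1 ∧
        (∫ l, ξa l ∂X) = Real.sin (θ / 2) ^ 2 ∧
        (∫ l, ξb l ∂X) = Real.sin (θ / 2) ^ 2 := by
  rintro ⟨Λ, _, X, _, A, B, ξa, ξb, hA, hB, ma, mb, ra, rb, ea, eb, hX, ia, ib⟩
  have Ia : Integrable ξa X := Integrable.of_bound ma.aestronglyMeasurable 1
    (Filter.Eventually.of_forall fun l => by
      rw [Real.norm_eq_abs, abs_of_nonneg (ra l).1]; exact (ra l).2)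
  have Ib : Integrable ξb X := Integrable.of_bound mb.aestronglyMeasurable 1
    (Filter.Eventually.of_forall fun l => by
      rw [Real.norm_eq_abs, abs_of_nonneg (rb l).1]; exact (rb l).2)
  have hae : ∀ᵐ l ∂X, l ∈ A ∪ B :=
    (mem_ae_iff_prob_eq_one (hA.union hB)).2 hX
  have h1 : (∫ _l, (1 : ℝ) ∂X) ≤ ∫ l, (ξa l + ξb l) ∂X := by
    apply integral_mono_ae (integrable_const _) (Ia.add Ib)
    filter_upwards [hae] with l hl
    rcases hl with h | h
    · have := ea l h
      have := (rb l).1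
      simp only [Pi.add_apply]
      linarith
    · have := eb l h
      have := (ra l).1
      simp only [Pi.add_apply]
      linarith
  rw [integral_add Ia Ib, ia, ib] at h1
  simp only [integral_const, probReal_univ, smul_eq_mul, mul_one] at h1
  have hc : 0 < Real.cos θ := Real.cos_pos_of_mem_Ioo ⟨by linarith, hθ1⟩
  have h2 : Real.cos θ = 2 * Real.cos (θ / 2) ^ 2 - 1 := by
    rw [← Real.cos_two_mul]; congr 1; ring
  have h3 := Real.sin_sq_add_cos_sq (θ / 2)
  linarith
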